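/- arXiv:1404.0488 — 4 statements merged into one kernel-verified Lean document; each statement's English description precedes it below -/
import Mathlib

section
/- Let ε > 0, r₀ > 0 and I₀ ∈ ℕ. Let K be a subset of ℓ² such that every u ∈ K satisfies ‖u‖ ≤ r₀ and Σ_{|i|>I₀} u_i² ≤ ε²/4. Then K can be covered by at most (⌊2r₀√(2I₀+1)/ε⌋ + 1)^{2I₀+1} open balls of radius ε in ℓ²; consequently the Kolmogorov ε-entropy of K satisfies 𝕂_ε(K) ≤ (2I₀+1)·ln(⌊2r₀√(2I₀+1)/ε⌋ + 1). -/
noncomputable section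

/-- `ℓ²`: the Hilbert space of square-summable real sequences indexed by `ℤ`. -/
abbrev l2 : Type := lp (fun _ : ℤ => ℝ) 2

/-- `nCov Y ε`: the minimal number `n ≥ 1` of open balls of radius `ε` needed to cover `Y`. -/
noncomputable def nCov (Y : Set l2) (ε : ℝ) : ℕ :=
  sInf {n : ℕ | 1 ≤ n ∧ ∃ c : Fin n → l2, Y ⊆ ⋃ j, Metric.ball (c j) ε}

/-- The Kolmogorov `ε`-entropy `𝕂_ε(Y) = ln n_ε(Y)`. -/
noncomputable def kolmogorovEntropy (Y : Set l2) (ε : ℝ) : ℝ :=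
  Real.log (nCov Y ε)

/-- The interval `[-r, r]` is covered by `M` closed intervals of half-length `r / M`. -/
theorem exists_fin_abs_sub_le {r x : ℝ} (hr : 0 < r) (hx : |x| ≤ r) {M : ℕ} (hM : 0 < M) :
    ∃ k : Fin M, |x - (-r + (2 * (k : ℕ) + 1) * (r / M))| ≤ r / M := by
  have hM' : (0 : ℝ) < M := by exact_mod_cast hM
  obtain ⟨d, hd⟩ : ∃ d, d = r / M := ⟨_, rfl⟩
  have hd0 : 0 < d := hd ▸ by positivity
  have hrd : r = M * d := by rw [hd]; field_simp
  obtain ⟨h1, h2⟩ := abs_le.1 hx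
  rw [← hd]
  have hy : 0 ≤ (x + r) / (2 * d) := div_nonneg (by linarith) (by linarith)
  by_cases hlt : ⌊(x + r) / (2 * d)⌋₊ < M
  · refine ⟨⟨_, hlt⟩, ?_⟩
    have a := Nat.floor_le hy
    have b := (Nat.lt_floor_add_one ((x + r) / (2 * d))).le
    rw [le_div_iff₀ (by positivity)] at a
    rw [div_le_iff₀ (by positivity)] at b
    rw [abs_le]
    constructor <;> simp only <;> nlinarith
  · refine ⟨⟨M - 1, by omega⟩, ?_⟩
    have a := (Nat.le_floor_iff hy).1 (not_lt.1 hlt)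
    rw [le_div_iff₀ (by positivity)] at a
    have hc : ((M - 1 : ℕ) : ℝ) = M - 1 := by rw [Nat.cast_sub hM]; simp
    simp only [hc]
    rw [abs_le]
    constructor <;> nlinarith

theorem l2_hasSum_sq (v : l2) : HasSum (fun i => (v i : ℝ) ^ 2) (‖v‖ ^ 2) := by
  have h := lp.hasSum_norm (p := 2) (by norm_num) v
  simpa using h

/-- The element of `l2` supported on `S` with the prescribed values there. -/
def l2OfFinset (S : Finset ℤ) (f : S → ℝ) : l2 :=
  ∑ i : S, lp.single 2 i.1 (f i)

theorem l2OfFinset_apply_mem (S : Finset ℤ) (f : S → ℝ) (i : S) :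
    l2OfFinset S f i.1 = f i := by
  simp only [l2OfFinset, lp.coeFn_sum, Finset.sum_apply, lp.single_apply]
  rw [Finset.sum_eq_single i]
  · simp
  · intro b _ hb
    rw [Pi.single_eq_of_ne]
    exact fun h => hb (Subtype.ext h.symm)
  · simp

theorem l2OfFinset_apply_notMem (S : Finset ℤ) (f : S → ℝ) {i : ℤ} (hi : i ∉ S) :
    l2OfFinset S f i = 0 := by
  simp only [l2OfFinset, lp.coeFn_sum, Finset.sum_apply, lp.single_apply]
  refine Finset.sum_eq_zero fun b _ => ?_
  rw [Pi.single_eq_of_ne]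
  rintro rfl
  exact hi b.2

theorem norm_sub_l2OfFinset_sq (u : l2) (S : Finset ℤ) (f : S → ℝ) :
    ‖u - l2OfFinset S f‖ ^ 2 =
      ∑ i : S, (u i.1 - f i) ^ 2 + ∑' i : {i : ℤ // i ∉ S}, (u i.1 : ℝ) ^ 2 := by
  have h := l2_hasSum_sq (u - l2OfFinset S f)
  rw [← h.tsum_eq, ← h.summable.sum_add_tsum_subtype_compl S, ← Finset.sum_coe_sort S]
  congr 1
  · refine Finset.sum_congr rfl fun i _ => ?_
    rw [lp.coeFn_sub, Pi.sub_apply, l2OfFinset_apply_mem]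
  · refine tsum_congr fun i => ?_
    rw [lp.coeFn_sub, Pi.sub_apply, l2OfFinset_apply_notMem S f i.2, sub_zero]

theorem stmt0 (ε r₀ : ℝ) (hε : 0 < ε) (hr₀ : 0 < r₀) (I₀ : ℕ)
    (K : Set l2)
    (hK : ∀ u ∈ K, ‖u‖ ≤ r₀ ∧
      (∑' i : {i : ℤ // (I₀ : ℤ) < |i|}, (u i.1 : ℝ) ^ 2) ≤ ε ^ 2 / 4) :
    (∃ c : Fin ((⌊2 * r₀ * Real.sqrt (2 * I₀ + 1) / ε⌋₊ + 1) ^ (2 * I₀ + 1)) → l2,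
        K ⊆ ⋃ j, Metric.ball (c j) ε) ∧
    kolmogorovEntropy K ε ≤
      (2 * I₀ + 1) * Real.log (⌊2 * r₀ * Real.sqrt (2 * I₀ + 1) / ε⌋₊ + 1) := by
  have hMlt := Nat.lt_floor_add_one (2 * r₀ * Real.sqrt (2 * I₀ + 1) / ε)
  have hcast : ((⌊2 * r₀ * Real.sqrt (2 * I₀ + 1) / ε⌋₊ : ℝ) + 1) =
    ((⌊2 * r₀ * Real.sqrt (2 * I₀ + 1) / ε⌋₊ + 1 : ℕ) : ℝ) := by push_cast; rfl
  rw [hcast] at hMlt ⊢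
  have hM : 0 < ⌊2 * r₀ * Real.sqrt (2 * I₀ + 1) / ε⌋₊ + 1 := Nat.succ_pos _
  generalize ⌊2 * r₀ * Real.sqrt (2 * I₀ + 1) / ε⌋₊ + 1 = M at hMlt hM ⊢
  have hM' : (0 : ℝ) < M := by exact_mod_cast hM
  have hcover : ∃ c : Fin (M ^ (2 * I₀ + 1)) → l2, K ⊆ ⋃ j, Metric.ball (c j) ε := by
    let S : Finset ℤ := Finset.Icc (-(I₀ : ℤ)) I₀
    have hS : S.card = 2 * I₀ + 1 := by simp only [S, Int.card_Icc]; omega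
    have hcard : Fintype.card (S → Fin M) = M ^ (2 * I₀ + 1) := by simp [hS]
    let e : (S → Fin M) ≃ Fin (M ^ (2 * I₀ + 1)) := Fintype.equivFinOfCardEq hcard
    refine ⟨fun j => l2OfFinset S fun i =>
      -r₀ + (2 * ((e.symm j i : Fin M) : ℕ) + 1) * (r₀ / M), fun u hu => ?_⟩
    obtain ⟨hnorm, htail⟩ := hK u hu
    have hcoord (i : S) : |(u i.1 : ℝ)| ≤ r₀ :=
      (lp.norm_apply_le_norm (by norm_num) u i.1).trans hnorm
    choose g hg using fun i => exists_fin_abs_sub_le hr₀ (hcoord i) hM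
    refine Set.mem_iUnion.2 ⟨e g, ?_⟩
    rw [Metric.mem_ball, dist_eq_norm]
    refine lt_of_pow_lt_pow_left₀ 2 hε.le ?_
    rw [norm_sub_l2OfFinset_sq]
    simp only [Equiv.symm_apply_apply]
    have hmem (i : ℤ) : i ∉ S ↔ (I₀ : ℤ) < |i| := by
      simp only [S, Finset.mem_Icc, ← abs_le, not_le]
    have htail' : ∑' i : {i : ℤ // i ∉ S}, (u i.1 : ℝ) ^ 2 ≤ ε ^ 2 / 4 := by
      rwa [← (Equiv.subtypeEquivRight hmem).tsum_eq] at htail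
    have hhead : ∑ i : S, (u i.1 - (-r₀ + (2 * ((g i : Fin M) : ℕ) + 1) * (r₀ / M))) ^ 2 ≤
        (2 * I₀ + 1) * (r₀ / M) ^ 2 := by
      calc _ ≤ ∑ _i : S, (r₀ / M) ^ 2 :=
            Finset.sum_le_sum fun i _ => sq_le_sq' (abs_le.1 (hg i)).1 (abs_le.1 (hg i)).2
        _ = _ := by simp [hS]
    have hsmall : (2 * I₀ + 1) * (r₀ / M) ^ 2 < ε ^ 2 / 4 := by
      rw [div_lt_iff₀ hε] at hMlt
      have hsq := pow_lt_pow_left₀ hMlt (by positivity) two_ne_zero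
      rw [mul_pow, Real.sq_sqrt (by positivity)] at hsq
      rw [div_pow, ← mul_div_assoc, div_lt_iff₀ (by positivity)]
      nlinarith
    nlinarith [sq_pos_of_pos hε]
  refine ⟨hcover, ?_⟩
  have hmem : M ^ (2 * I₀ + 1) ∈
      {n : ℕ | 1 ≤ n ∧ ∃ c : Fin n → l2, K ⊆ ⋃ j, Metric.ball (c j) ε} :=
    ⟨Nat.one_le_pow _ _ hM, hcover⟩
  have hpos : 0 < nCov K ε := (Nat.sInf_mem ⟨_, hmem⟩).1
  have hle : nCov K ε ≤ M ^ (2 * I₀ + 1) := Nat.sInf_le hmem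
  calc kolmogorovEntropy K ε ≤ Real.log ((M : ℝ) ^ (2 * I₀ + 1)) :=
        Real.log_le_log (by exact_mod_cast hpos) (by exact_mod_cast hle)
    _ = _ := by rw [Real.log_pow]; push_cast; ring
end
end

section
/- Let ω : ℝ → ℝ be continuous with lim_{t→+∞} ω(t)/t = 0 and lim_{t→−∞} ω(t)/t = 0. For t ∈ ℝ define the shifted path θ_t ω by (θ_t ω)(s) = ω(s+t) − ω(t). Then for every t ∈ ℝ the number z(θ_t ω) = −∫_{−∞}^0 e^r (ω(r+t) − ω(t)) dr is well defined, and lim_{t→+∞} z(θ_t ω)/t = 0 as well as lim_{t→−∞} z(θ_t ω)/t = 0. -/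
open MeasureTheory Filter

noncomputable section

/-- A continuous function of sublinear growth is bounded by an affine function of `|s|` with
arbitrarily small slope. -/
theorem exists_abs_le_mul_abs_add_of_sublinear {ω : ℝ → ℝ} (hc : Continuous ω)
    (h1 : Tendsto (fun t => ω t / t) atTop (nhds 0))
    (h2 : Tendsto (fun t => ω t / t) atBot (nhds 0)) {ε : ℝ} (hε : 0 < ε) :
    ∃ C, ∀ s, |ω s| ≤ ε * |s| + C := by
  have key : ∀ s, s ≠ 0 → |ω s / s| < ε → |ω s| ≤ ε * |s| := by
    intro s hs h
    rw [abs_div, div_lt_iff₀ (abs_pos.2 hs)] at h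
    exact h.le
  have e1 : ∀ᶠ t in atTop, |ω t| ≤ ε * |t| := by
    filter_upwards [Metric.tendsto_nhds.1 h1 ε hε, eventually_gt_atTop 0] with t ht h0
    exact key t h0.ne' (by rwa [Real.dist_eq, sub_zero] at ht)
  have e2 : ∀ᶠ t in atBot, |ω t| ≤ ε * |t| := by
    filter_upwards [Metric.tendsto_nhds.1 h2 ε hε, eventually_lt_atBot 0] with t ht h0
    exact key t h0.ne (by rwa [Real.dist_eq, sub_zero] at ht)
  obtain ⟨b, hb⟩ := eventually_atTop.1 e1
  obtain ⟨a, ha⟩ := eventually_atBot.1 e2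
  obtain ⟨C, hC⟩ := (isCompact_Icc (a := a) (b := b)).exists_bound_of_continuousOn hc.continuousOn
  refine ⟨max C 0, fun s => ?_⟩
  have hm := le_max_right C 0
  have hs : 0 ≤ ε * |s| := by positivity
  rcases le_total s a with h | h
  · linarith [ha s h]
  rcases le_total b s with h' | h'
  · linarith [hb s h']
  · have := hC s ⟨h, h'⟩
    rw [Real.norm_eq_abs] at this
    linarith [le_max_left C 0]

theorem exp_mul_neg_le_two_mul_exp_half (r : ℝ) :
    Real.exp r * (-r) ≤ 2 * Real.exp ((1 / 2) * r) := by
  have h : Real.exp r = Real.exp ((1 / 2) * r) * Real.exp ((1 / 2) * r) := by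
    rw [← Real.exp_add]; ring_nf
  have h' : Real.exp ((1 / 2) * r) * (-r / 2) ≤ 1 := by
    have := Real.add_one_le_exp (-((1 / 2) * r))
    calc Real.exp ((1 / 2) * r) * (-r / 2)
        ≤ Real.exp ((1 / 2) * r) * Real.exp (-((1 / 2) * r)) := by
          gcongr; linarith
      _ = 1 := by rw [← Real.exp_add]; simp
  rw [h]
  nlinarith [Real.exp_pos ((1 / 2) * r)]

theorem norm_exp_mul_shift_le {ω : ℝ → ℝ} {ε C : ℝ} (hε : 0 ≤ ε)
    (h : ∀ s, |ω s| ≤ ε * |s| + C) (t : ℝ) {r : ℝ} (hr : r ≤ 0) :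
    ‖Real.exp r * (ω (r + t) - ω t)‖ ≤
      2 * ε * Real.exp ((1 / 2) * r) + (2 * ε * |t| + 2 * C) * Real.exp (1 * r) := by
  have a1 : |ω (r + t) - ω t| ≤ ε * (-r) + (2 * ε * |t| + 2 * C) := by
    have ht : |r + t| ≤ -r + |t| := by
      simpa [abs_of_nonpos hr] using abs_add_le r t
    have := mul_le_mul_of_nonneg_left ht hε
    linarith [abs_sub (ω (r + t)) (ω t), h (r + t), h t]
  rw [norm_mul, Real.norm_eq_abs, Real.norm_eq_abs, Real.abs_exp, one_mul]
  have a2 := mul_le_mul_of_nonneg_left a1 (Real.exp_pos r).le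
  have a3 := mul_le_mul_of_nonneg_left (exp_mul_neg_le_two_mul_exp_half r) hε
  linarith

theorem integrableOn_exp_dominant (A B : ℝ) :
    IntegrableOn (fun r : ℝ => A * Real.exp ((1 / 2) * r) + B * Real.exp (1 * r)) (Set.Iic 0) :=
  ((integrableOn_exp_mul_Iic (by norm_num) 0).const_mul A).add
    ((integrableOn_exp_mul_Iic one_pos 0).const_mul B)

theorem abs_integral_exp_mul_shift_le {ω : ℝ → ℝ} {ε C : ℝ} (hε : 0 ≤ ε)
    (h : ∀ s, |ω s| ≤ ε * |s| + C) (t : ℝ) :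
    |∫ r in Set.Iic (0 : ℝ), Real.exp r * (ω (r + t) - ω t)| ≤
      4 * ε + 2 * ε * |t| + 2 * C := by
  have hle := norm_integral_le_of_norm_le
    (integrableOn_exp_dominant (2 * ε) (2 * ε * |t| + 2 * C))
    ((ae_restrict_iff' measurableSet_Iic).2
      (Eventually.of_forall fun r hr => norm_exp_mul_shift_le hε h t hr))
  rw [integral_add ((integrableOn_exp_mul_Iic (by norm_num) 0).const_mul _)
    ((integrableOn_exp_mul_Iic one_pos 0).const_mul _), integral_const_mul, integral_const_mul,
    integral_exp_mul_Iic (by norm_num), integral_exp_mul_Iic one_pos] at hle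
  norm_num at hle
  linarith

theorem stmt4 (ω : ℝ → ℝ) (hc : Continuous ω)
    (h1 : Tendsto (fun t => ω t / t) atTop (nhds 0))
    (h2 : Tendsto (fun t => ω t / t) atBot (nhds 0)) :
    (∀ t : ℝ,
      IntegrableOn (fun r => Real.exp r * (ω (r + t) - ω t)) (Set.Iic 0)) ∧
    Tendsto
      (fun t => (-∫ r in Set.Iic (0 : ℝ), Real.exp r * (ω (r + t) - ω t)) / t)
      atTop (nhds 0) ∧
    Tendsto
      (fun t => (-∫ r in Set.Iic (0 : ℝ), Real.exp r * (ω (r + t) - ω t)) / t)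
      atBot (nhds 0) := by
  refine ⟨fun t => ?_, ?_⟩
  · obtain ⟨C, hC⟩ := exists_abs_le_mul_abs_add_of_sublinear hc h1 h2 one_pos
    refine (integrableOn_exp_dominant (2 * 1) (2 * 1 * |t| + 2 * C)).mono'
      (by fun_prop) ?_
    exact (ae_restrict_iff' measurableSet_Iic).2
      (Eventually.of_forall fun r hr => norm_exp_mul_shift_le zero_le_one hC t hr)
  · suffices H : ∀ l : Filter ℝ, Tendsto (fun t : ℝ => |t|) l atTop → Tendsto
        (fun t => (-∫ r in Set.Iic (0 : ℝ), Real.exp r * (ω (r + t) - ω t)) / t) l (nhds 0) from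
      ⟨H _ tendsto_abs_atTop_atTop, H _ tendsto_abs_atBot_atTop⟩
    intro l hl
    rw [Metric.tendsto_nhds]
    intro δ hδ
    have hε : 0 < δ / 4 := by positivity
    obtain ⟨C, hC⟩ := exists_abs_le_mul_abs_add_of_sublinear hc h1 h2 hε
    filter_upwards [hl.eventually_gt_atTop 0,
      hl.eventually_gt_atTop ((4 * (δ / 4) + 2 * C) / (δ / 2))] with t ht0 ht
    rw [div_lt_iff₀ (by positivity)] at ht
    rw [Real.dist_eq, sub_zero, abs_div, abs_neg, div_lt_iff₀ ht0]
    linarith [abs_integral_exp_mul_shift_le hε.le hC t]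
end
end

section
/- Let ζ : ℝ → ℝ be continuous with lim_{s→−∞} ζ(s)/s = 0 and lim_{s→−∞} (1/|s|)·∫_s^0 ζ(r) dr = 0. Then for every γ > 0 and every λ̂ > 0, lim_{t→+∞} e^{−γ t} ∫_{−∞}^{−t} exp( λ̂ (s+t) − 2ζ(s) + 2∫_s^0 ζ(r) dr ) ds = 0. -/
open MeasureTheory Filter

noncomputable section

theorem stmt6 (ζ : ℝ → ℝ) (hc : Continuous ζ)
    (h1 : Tendsto (fun s => ζ s / s) atBot (nhds 0))
    (h2 : Tendsto (fun s => (1 / |s|) * ∫ r in s..0, ζ r) atBot (nhds 0)) :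
    ∀ γ lamHat : ℝ, 0 < γ → 0 < lamHat →
      Tendsto
        (fun t => Real.exp (-γ * t) *
          ∫ s in Set.Iic (-t),
            Real.exp (lamHat * (s + t) - 2 * ζ s + 2 * ∫ r in s..0, ζ r))
        atTop (nhds 0) := by
  intro γ lamHat hγ hlam
  obtain ⟨ε, hε, hεγ, hεlam⟩ : ∃ ε : ℝ, 0 < ε ∧ 4 * ε < γ ∧ 4 * ε < lamHat := by
    refine ⟨min γ lamHat / 8, by positivity, ?_, ?_⟩
    · linarith [min_le_left γ lamHat]
    · linarith [min_le_right γ lamHat]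
  have ha : 0 < lamHat - 4 * ε := by linarith
  have hbound : ∀ᶠ s in atBot, -ζ s + ∫ r in s..0, ζ r ≤ 2 * ε * (-s) := by
    filter_upwards [h1.eventually_lt_const hε, h2.eventually_lt_const hε,
      eventually_lt_atBot (0 : ℝ)] with s hs₁ hs₂ hs
    rw [div_lt_iff_of_neg hs] at hs₁
    rw [abs_of_neg hs, one_div, inv_mul_lt_iff₀ (neg_pos.2 hs)] at hs₂
    linarith
  obtain ⟨S, hS⟩ := eventually_atBot.1 hbound
  have hlim : Tendsto (fun t : ℝ => Real.exp (-(γ - 4 * ε) * t) / (lamHat - 4 * ε))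
      atTop (nhds 0) := by
    have h := (Real.tendsto_exp_atBot.comp
      (tendsto_id.const_mul_atTop_of_neg (by linarith : -(γ - 4 * ε) < 0))).div_const
      (lamHat - 4 * ε)
    simpa using h
  refine squeeze_zero' (.of_forall fun t => ?_) ?_ hlim
  · exact mul_nonneg (Real.exp_nonneg _) (integral_nonneg fun s => Real.exp_nonneg _)
  filter_upwards [eventually_ge_atTop (-S)] with t ht
  calc
    _ ≤ Real.exp (-γ * t) * ∫ s in Set.Iic (-t),
          Real.exp (lamHat * t) * Real.exp ((lamHat - 4 * ε) * s) := by
      refine mul_le_mul_of_nonneg_left (integral_mono_of_nonneg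
        (.of_forall fun s => Real.exp_nonneg _)
        ((integrableOn_exp_mul_Iic ha _).const_mul _) ?_) (Real.exp_nonneg _)
      filter_upwards [ae_restrict_mem measurableSet_Iic] with s hs
      have hs' : s ≤ S := by linarith [Set.mem_Iic.1 hs]
      rw [← Real.exp_add]
      exact Real.exp_le_exp.2 (by linarith [hS s hs'])
    _ = Real.exp (-(γ - 4 * ε) * t) / (lamHat - 4 * ε) := by
      rw [integral_const_mul, integral_exp_mul_Iic ha, ← mul_assoc, ← mul_div_assoc,
        ← Real.exp_add, ← Real.exp_add]
      ring_nf
end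
end

section
/- Assume (A1)–(A4) and let z : ℝ → ℝ be continuous. Then for every τ ∈ ℝ and every initial datum v_τ ∈ ℓ² there exists a unique differentiable map v : [τ, ∞) → ℓ² with v(τ) = v_τ that is a solution of the transformed lattice equation on [τ, ∞); i.e., the solution exists globally in forward time and is unique. -/
noncomputable section

/-- The right-hand side of the transformed lattice equation
`v' = -ν(t) A v - λ(t) v - e^{-z(t)} f(e^{z(t)} v, t) + e^{-z(t)} g(t) + z(t) v`,
written coordinatewise. -/
def latticeRHS (nu lam : ℤ → ℝ → ℝ) (f : ℤ → ℝ → ℝ → ℝ) (g : ℝ → l2) (z : ℝ → ℝ)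
    (v : l2) (t : ℝ) (i : ℤ) : ℝ :=
  -nu i t * (-(v (i - 1)) + 2 * v i - v (i + 1)) - lam i t * v i
    - Real.exp (-z t) * f i (Real.exp (z t) * v i) t
    + Real.exp (-z t) * g t i + z t * v i

/-- `v` (with derivative `v'`) is a solution of the transformed lattice equation on `J`. -/
def IsSolOn (nu lam : ℤ → ℝ → ℝ) (f : ℤ → ℝ → ℝ → ℝ) (g : ℝ → l2) (z : ℝ → ℝ)
    (v v' : ℝ → l2) (J : Set ℝ) : Prop :=
  ∀ t ∈ J, HasDerivWithinAt v (v' t) J t ∧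
    ∀ i : ℤ, (v' t) i = latticeRHS nu lam f g z (v t) t i

open Set Metric Filter Topology
open scoped NNReal

section EnergyODE

variable {E : Type*} [NormedAddCommGroup E]

/-- The radial retraction onto the closed ball of radius `R` around the origin. -/
def radialRetraction [NormedSpace ℝ E] (R : ℝ) (x : E) : E := (R / max R ‖x‖) • x

lemma radialRetraction_of_norm_le [NormedSpace ℝ E] {R : ℝ} (hR : 0 < R) {x : E} (hx : ‖x‖ ≤ R) :
    radialRetraction R x = x := by
  rw [radialRetraction, max_eq_left hx, div_self hR.ne', one_smul]

lemma norm_radialRetraction_le [NormedSpace ℝ E] {R : ℝ} (hR : 0 < R) (x : E) :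
    ‖radialRetraction R x‖ ≤ R := by
  have hm : 0 < max R ‖x‖ := lt_max_of_lt_left hR
  rw [radialRetraction, norm_smul, Real.norm_of_nonneg (by positivity), div_mul_eq_mul_div,
    div_le_iff₀ hm]
  exact mul_le_mul_of_nonneg_left (le_max_right _ _) hR.le

lemma lipschitzWith_radialRetraction [NormedSpace ℝ E] {R : ℝ} (hR : 0 < R) :
    LipschitzWith 2 (radialRetraction R : E → E) := by
  refine LipschitzWith.of_dist_le_mul fun x y => ?_
  rw [dist_eq_norm, dist_eq_norm]
  have hx : 0 < max R ‖x‖ := lt_max_of_lt_left hR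
  have hy : 0 < max R ‖y‖ := lt_max_of_lt_left hR
  have hsplit : radialRetraction R x - radialRetraction R y
      = (R / max R ‖x‖) • (x - y) + (R / max R ‖x‖ - R / max R ‖y‖) • y := by
    simp only [radialRetraction, smul_sub, sub_smul]; abel
  have h1 : ‖(R / max R ‖x‖) • (x - y)‖ ≤ ‖x - y‖ := by
    rw [norm_smul, Real.norm_of_nonneg (by positivity)]
    exact mul_le_of_le_one_left (norm_nonneg _) ((div_le_one hx).2 (le_max_left _ _))
  have h2 : ‖(R / max R ‖x‖ - R / max R ‖y‖) • y‖ ≤ ‖x - y‖ := by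
    have hmax : |max R ‖y‖ - max R ‖x‖| ≤ ‖x - y‖ := by
      refine (abs_max_sub_max_le_max R ‖y‖ R ‖x‖).trans ?_
      rw [sub_self, abs_zero, max_eq_right (abs_nonneg _), norm_sub_rev]
      exact abs_norm_sub_norm_le y x
    have heq : R / max R ‖x‖ - R / max R ‖y‖
        = (max R ‖y‖ - max R ‖x‖) * (R / max R ‖x‖ / max R ‖y‖) := by
      field_simp
    rw [norm_smul, heq, norm_mul, Real.norm_eq_abs, mul_assoc]
    refine (mul_le_of_le_one_right (abs_nonneg _) ?_).trans hmax
    rw [Real.norm_of_nonneg (by positivity), div_mul_eq_mul_div, div_le_one hy]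
    exact mul_le_mul ((div_le_one hx).2 (le_max_left _ _)) (le_max_right _ _) (norm_nonneg _)
      zero_le_one |>.trans (one_mul _).le
  calc _ ≤ ‖x - y‖ + ‖x - y‖ := by rw [hsplit]; exact (norm_add_le _ _).trans (add_le_add h1 h2)
    _ = (2 : ℝ≥0) * ‖x - y‖ := by push_cast; ring

/-- Solutions of an ODE whose right-hand side is Lipschitz on balls are unique. -/
lemma eqOn_of_lipschitzOn_balls [NormedSpace ℝ E] {F : ℝ → E → E} {a b : ℝ}
    (hlip : ∀ R : ℝ, ∃ K : ℝ≥0, ∀ t ∈ Icc a b, LipschitzOnWith K (F t) (closedBall 0 R))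
    {u v : ℝ → E} (hu : ∀ t ∈ Icc a b, HasDerivWithinAt u (F t (u t)) (Icc a b) t)
    (hv : ∀ t ∈ Icc a b, HasDerivWithinAt v (F t (v t)) (Icc a b) t) (h0 : u a = v a) :
    EqOn u v (Icc a b) := by
  have huc : ContinuousOn u (Icc a b) := fun t ht => (hu t ht).continuousWithinAt
  have hvc : ContinuousOn v (Icc a b) := fun t ht => (hv t ht).continuousWithinAt
  obtain ⟨A, hA⟩ := isCompact_Icc.exists_bound_of_continuousOn huc
  obtain ⟨B, hB⟩ := isCompact_Icc.exists_bound_of_continuousOn hvc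
  obtain ⟨K, hK⟩ := hlip (max A B)
  refine ODE_solution_unique_of_mem_Icc_right (s := fun _ => closedBall 0 (max A B))
    (fun t ht => hK t (Ico_subset_Icc_self ht)) huc
    (fun t ht => (hu t (Ico_subset_Icc_self ht)).mono_of_mem_nhdsWithin
      (Icc_mem_nhdsGE_of_mem ht))
    (fun t ht => ?_) hvc
    (fun t ht => (hv t (Ico_subset_Icc_self ht)).mono_of_mem_nhdsWithin
      (Icc_mem_nhdsGE_of_mem ht))
    (fun t ht => ?_) h0
  · exact mem_closedBall_zero_iff.2 ((hA t (Ico_subset_Icc_self ht)).trans (le_max_left _ _))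
  · exact mem_closedBall_zero_iff.2 ((hB t (Ico_subset_Icc_self ht)).trans (le_max_right _ _))

/-- A bounded, globally Lipschitz, time-continuous vector field has solutions on every compact
interval. -/
lemma exists_solution_Icc_of_bounded [NormedSpace ℝ E] [CompleteSpace E]
    {F : ℝ → E → E} {a b : ℝ} (hab : a ≤ b) {K L : ℝ≥0}
    (hlip : ∀ t ∈ Icc a b, LipschitzWith K (F t))
    (hcont : ∀ x, ContinuousOn (fun t => F t x) (Icc a b))
    (hbound : ∀ t ∈ Icc a b, ∀ x, ‖F t x‖ ≤ L) (x₀ : E) :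
    ∃ v : ℝ → E, v a = x₀ ∧ ∀ t ∈ Icc a b, HasDerivWithinAt v (F t (v t)) (Icc a b) t := by
  have hPL : IsPicardLindelof F (⟨a, left_mem_Icc.2 hab⟩ : Icc a b) x₀
      (L * (b - a).toNNReal) 0 L K :=
    { lipschitzOnWith := fun t ht => (hlip t ht).lipschitzOnWith
      continuousOn := fun x _ => hcont x
      norm_le := fun t ht x _ => hbound t ht x
      mul_max_le := by
        rw [sub_self, max_eq_left (sub_nonneg.2 hab), NNReal.coe_mul, NNReal.coe_zero, sub_zero,
          Real.coe_toNNReal _ (sub_nonneg.2 hab)] }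
  exact hPL.exists_eq_forall_mem_Icc_hasDerivWithinAt₀

variable [InnerProductSpace ℝ E]

/-- An energy inequality gives an a priori bound for the solution of an ODE. -/
lemma norm_sq_le_gronwallBound {v v' : ℝ → E} {a b C : ℝ}
    (hv : ∀ t ∈ Icc a b, HasDerivWithinAt v (v' t) (Icc a b) t)
    (henergy : ∀ t ∈ Icc a b, inner ℝ (v' t) (v t) ≤ C * (1 + ‖v t‖ ^ 2)) :
    ∀ t ∈ Icc a b, ‖v t‖ ^ 2 ≤ gronwallBound (‖v a‖ ^ 2) (2 * C) (2 * C) (t - a) := by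
  refine le_gronwallBound_of_liminf_deriv_right_le (f' := fun t => 2 * inner ℝ (v t) (v' t))
    (fun t ht => (hv t ht).norm_sq.continuousWithinAt) (fun t ht r hr => ?_) le_rfl
    (fun t ht => ?_)
  · have := ((hv t (Ico_subset_Icc_self ht)).mono_of_mem_nhdsWithin
      (Icc_mem_nhdsGE_of_mem ht)).norm_sq.liminf_right_slope_le hr
    simpa [slope_def_field, div_eq_inv_mul] using this
  · have := henergy t (Ico_subset_Icc_self ht)
    rw [real_inner_comm] at this
    nlinarith

lemma inner_comp_radialRetraction_le {G : E → E} {C R : ℝ} (hC : 0 ≤ C) (hR : 1 ≤ R)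
    (hG : ∀ x, inner ℝ (G x) x ≤ C * (1 + ‖x‖ ^ 2)) (x : E) :
    inner ℝ (G (radialRetraction R x)) x ≤ 2 * C * (1 + ‖x‖ ^ 2) := by
  have hR0 : 0 < R := zero_lt_one.trans_le hR
  rcases le_total ‖x‖ R with hx | hx
  · rw [radialRetraction_of_norm_le hR0 hx]
    nlinarith [hG x, mul_nonneg hC (add_nonneg zero_le_one (sq_nonneg ‖x‖))]
  · have hx0 : 0 < ‖x‖ := hR0.trans_le hx
    have hxr : x = (‖x‖ / R) • radialRetraction R x := by
      rw [radialRetraction, max_eq_right hx, smul_smul, div_mul_div_cancel₀ hR0.ne',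
        div_self hx0.ne', one_smul]
    have hs : 1 ≤ ‖x‖ / R := (one_le_div hR0).2 hx
    have hsx : ‖x‖ / R ≤ ‖x‖ := div_le_self hx0.le hR
    have hsR : ‖x‖ / R * R = ‖x‖ := div_mul_cancel₀ _ hR0.ne'
    calc inner ℝ (G (radialRetraction R x)) x
        = ‖x‖ / R * inner ℝ (G (radialRetraction R x)) (radialRetraction R x) := by
          conv_lhs => rw [hxr]
          rw [inner_smul_right, ← hxr]
      _ ≤ ‖x‖ / R * (C * (1 + R ^ 2)) := by
          refine mul_le_mul_of_nonneg_left ((hG _).trans ?_) (by positivity)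
          have := norm_radialRetraction_le hR0 x
          gcongr
      _ = C * (‖x‖ / R + ‖x‖ * R) := by rw [← hsR]; field_simp
      _ ≤ 2 * C * (1 + ‖x‖ ^ 2) := by
          rw [mul_comm 2 C, mul_assoc]
          refine mul_le_mul_of_nonneg_left ?_ hC
          nlinarith

/-- Existence on a compact interval for an ODE in a Hilbert space whose right-hand side is
Lipschitz on balls and satisfies an energy inequality. -/
lemma exists_solution_Icc_of_energy [CompleteSpace E] {F : ℝ → E → E} {a b C : ℝ} (hab : a ≤ b)
    (hC : 0 ≤ C)
    (hlip : ∀ R : ℝ, ∃ K : ℝ≥0, ∀ t ∈ Icc a b, LipschitzOnWith K (F t) (closedBall 0 R))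
    (hcont : ∀ x, ContinuousOn (fun t => F t x) (Icc a b))
    (henergy : ∀ t ∈ Icc a b, ∀ x, inner ℝ (F t x) x ≤ C * (1 + ‖x‖ ^ 2)) (x₀ : E) :
    ∃ v : ℝ → E, v a = x₀ ∧ ∀ t ∈ Icc a b, HasDerivWithinAt v (F t (v t)) (Icc a b) t := by
  set M := gronwallBound (‖x₀‖ ^ 2) (2 * (2 * C)) (2 * (2 * C)) (b - a) with hM
  set R := 1 + |M| with hR
  have hR1 : 1 ≤ R := by rw [hR]; linarith [abs_nonneg M]
  have hR0 : 0 < R := by linarith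
  obtain ⟨K, hK⟩ := hlip R
  obtain ⟨A, hA⟩ := isCompact_Icc.exists_bound_of_continuousOn (hcont 0)
  have hmem : ∀ x : E, radialRetraction R x ∈ closedBall (0 : E) R := fun x =>
    mem_closedBall_zero_iff.2 (norm_radialRetraction_le hR0 x)
  obtain ⟨v, hv0, hv⟩ := exists_solution_Icc_of_bounded (F := fun t x => F t (radialRetraction R x))
    hab (K := K * 2) (L := Real.toNNReal (A + K * R))
    (fun t ht => by
      rw [← lipschitzOnWith_univ]
      exact (hK t ht).comp (lipschitzWith_radialRetraction hR0).lipschitzOnWith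
        fun x _ => hmem x)
    (fun x => hcont _)
    (fun t ht x => by
      refine le_trans ?_ (Real.le_coe_toNNReal _)
      have h1 := (hK t ht).dist_le_mul _ (hmem x) 0 (mem_closedBall_self hR0.le)
      rw [dist_eq_norm, dist_zero_right] at h1
      have h2 := mul_le_mul_of_nonneg_left (norm_radialRetraction_le hR0 x) K.coe_nonneg
      have h3 := norm_sub_norm_le (F t (radialRetraction R x)) (F t 0)
      linarith [hA t ht]) x₀
  refine ⟨v, hv0, fun t ht => ?_⟩
  have hbound : ‖v t‖ ≤ R := by
    have h1 := norm_sq_le_gronwallBound hv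
      (fun t ht => inner_comp_radialRetraction_le hC hR1 (henergy t ht) (v t)) t ht
    have h2 : ‖v t‖ ^ 2 ≤ M := by
      rw [hv0] at h1
      exact h1.trans (gronwallBound_mono (by positivity) (by positivity) (by positivity)
        (sub_le_sub_right ht.2 a))
    refine le_of_sq_le_sq ?_ hR0.le
    nlinarith [le_abs_self M, abs_nonneg M]
  have := hv t ht
  rwa [radialRetraction_of_norm_le hR0 hbound] at this

/-- Global forward existence for an ODE in a Hilbert space whose right-hand side is Lipschitz on
balls and satisfies an energy inequality, locally uniformly in time. -/
theorem exists_solution_Ici_of_energy [CompleteSpace E] {F : ℝ → E → E} {a : ℝ}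
    (hlip : ∀ b R : ℝ, ∃ K : ℝ≥0, ∀ t ∈ Icc a b, LipschitzOnWith K (F t) (closedBall 0 R))
    (hcont : ∀ x, Continuous (fun t => F t x))
    (henergy : ∀ b, ∃ C, 0 ≤ C ∧ ∀ t ∈ Icc a b, ∀ x, inner ℝ (F t x) x ≤ C * (1 + ‖x‖ ^ 2))
    (x₀ : E) :
    ∃ v : ℝ → E, v a = x₀ ∧ ∀ t ∈ Ici a, HasDerivWithinAt v (F t (v t)) (Ici a) t := by
  have hex : ∀ n : ℕ, ∃ v : ℝ → E, v a = x₀ ∧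
      ∀ t ∈ Icc a (a + n), HasDerivWithinAt v (F t (v t)) (Icc a (a + n)) t := fun n => by
    obtain ⟨C, hC, hCF⟩ := henergy (a + n)
    exact exists_solution_Icc_of_energy (by simp) hC (hlip _) (fun x => (hcont x).continuousOn)
      hCF x₀
  choose w hw0 hw using hex
  have hmono : ∀ m n : ℕ, m ≤ n → EqOn (w m) (w n) (Icc a (a + m)) := fun m n hmn => by
    have hsub : Icc a (a + m) ⊆ Icc a (a + n) := Icc_subset_Icc_right (by gcongr)
    exact eqOn_of_lipschitzOn_balls (hlip _) (hw m)
      (fun t ht => (hw n t (hsub ht)).mono hsub) ((hw0 m).trans (hw0 n).symm)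
  have hagree : ∀ m n : ℕ, ∀ t, a ≤ t → t ≤ a + m → t ≤ a + n → w m t = w n t :=
    fun m n t h0 hm hn => by
      rcases le_total m n with h | h
      · exact hmono m n h ⟨h0, hm⟩
      · exact (hmono n m h ⟨h0, hn⟩).symm
  have hceil : ∀ t : ℝ, t ≤ a + (⌈t - a⌉₊ : ℕ) := fun t => by linarith [Nat.le_ceil (t - a)]
  set v : ℝ → E := fun t => w ⌈t - a⌉₊ t with hvdef
  have hvw : ∀ n : ℕ, EqOn v (w n) (Icc a (a + n)) := fun n t ht =>
    hagree _ n t ht.1 (hceil t) ht.2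
  refine ⟨v, by rw [hvw 0 ⟨le_rfl, by simp⟩, hw0], fun t ht => ?_⟩
  obtain ⟨n, hn⟩ := exists_nat_gt (t - a)
  have htn : t ∈ Icc a (a + n) := ⟨ht, by linarith⟩
  have h := (hw n t htn).congr (hvw n) (hvw n htn)
  rw [← hvw n htn] at h
  refine h.mono_of_mem_nhdsWithin ?_
  rw [← Ici_inter_Iic]
  exact inter_mem_nhdsWithin _ (Iic_mem_nhds (by linarith))

end EnergyODE

section LatticeOperators

/-- A sequence of time-dependent real functions vanishing at the origin, continuous in time and
Lipschitz on bounded sets uniformly in the index and locally uniformly in time. -/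
structure IsUniformlyLocLip (h : ℤ → ℝ → ℝ → ℝ) : Prop where
  map_zero : ∀ i t, h i t 0 = 0
  continuous_time : ∀ i x, Continuous fun t => h i t x
  exists_lipschitz : ∀ a b R : ℝ, ∃ K : ℝ, 0 ≤ K ∧ ∀ t ∈ Icc a b, ∀ i x y, |x| ≤ R → |y| ≤ R →
    |h i t x - h i t y| ≤ K * |x - y|

lemma abs_apply_le_norm (x : l2) (i : ℤ) : |x i| ≤ ‖x‖ :=
  lp.norm_apply_le_norm two_ne_zero x i

lemma norm_le_mul_norm_of_abs_le {x y : l2} {K : ℝ} (hK : 0 ≤ K)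
    (h : ∀ i, |x i| ≤ K * |y i|) : ‖x‖ ≤ K * ‖y‖ := by
  have h1 : ‖x‖ ≤ ‖K • y‖ := by
    refine lp.norm_mono two_ne_zero fun i => ?_
    rw [lp.coeFn_smul, Pi.smul_apply, norm_smul, Real.norm_of_nonneg hK]
    exact h i
  rwa [norm_smul, Real.norm_of_nonneg hK] at h1

lemma IsUniformlyLocLip.memℓp {h : ℤ → ℝ → ℝ → ℝ} (hh : IsUniformlyLocLip h) (t : ℝ) (x : l2) :
    Memℓp (fun i => h i t (x i)) 2 := by
  obtain ⟨K, hK, hL⟩ := hh.exists_lipschitz t t ‖x‖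
  refine (lp.memℓp (K • x)).mono' fun i => ?_
  have := hL t ⟨le_rfl, le_rfl⟩ i (x i) 0 (abs_apply_le_norm x i) (by simp)
  rw [hh.map_zero, sub_zero, sub_zero] at this
  rw [lp.coeFn_smul, Pi.smul_apply, norm_smul, Real.norm_of_nonneg hK]
  exact this

/-- The Nemytskii (superposition) operator on `ℓ²` induced by a sequence of real functions. -/
def nemytskii {h : ℤ → ℝ → ℝ → ℝ} (hh : IsUniformlyLocLip h) (t : ℝ) (x : l2) : l2 :=
  ⟨fun i => h i t (x i), hh.memℓp t x⟩

lemma nemytskii_apply {h : ℤ → ℝ → ℝ → ℝ} (hh : IsUniformlyLocLip h) (t : ℝ) (x : l2) (i : ℤ) :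
    nemytskii hh t x i = h i t (x i) := rfl

lemma exists_lipschitzOnWith_nemytskii {h : ℤ → ℝ → ℝ → ℝ} (hh : IsUniformlyLocLip h)
    (a b R : ℝ) :
    ∃ K : ℝ≥0, ∀ t ∈ Icc a b, LipschitzOnWith K (nemytskii hh t) (closedBall 0 R) := by
  obtain ⟨K, hK, hL⟩ := hh.exists_lipschitz a b R
  refine ⟨⟨K, hK⟩, fun t ht => LipschitzOnWith.of_dist_le_mul fun x hx y hy => ?_⟩
  rw [dist_eq_norm, dist_eq_norm]
  rw [mem_closedBall_zero_iff] at hx hy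
  refine norm_le_mul_norm_of_abs_le hK fun i => ?_
  rw [lp.coeFn_sub, lp.coeFn_sub, Pi.sub_apply, Pi.sub_apply]
  exact hL t ht i _ _ ((abs_apply_le_norm x i).trans hx) ((abs_apply_le_norm y i).trans hy)

lemma norm_sq_eq_tsum (x : l2) : ‖x‖ ^ 2 = ∑' i, x i ^ 2 := by
  have := lp.norm_rpow_eq_tsum (p := 2) (by simp) x
  simpa using this

lemma summable_sq (x : l2) : Summable fun i => x i ^ 2 := by
  have := (lp.memℓp x).summable (by simp)
  simpa using this

lemma continuous_nemytskii {h : ℤ → ℝ → ℝ → ℝ} (hh : IsUniformlyLocLip h) (x : l2) :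
    Continuous fun t => nemytskii hh t x := by
  refine continuous_iff_continuousAt.2 fun s => ?_
  obtain ⟨K, hK, hL⟩ := hh.exists_lipschitz (s - 1) (s + 1) ‖x‖
  have hb : ∀ t ∈ Icc (s - 1) (s + 1), ∀ i, |h i t (x i)| ≤ K * |x i| := fun t ht i => by
    simpa [hh.map_zero] using hL t ht i (x i) 0 (abs_apply_le_norm x i) (by simp)
  have hs : s ∈ Icc (s - 1) (s + 1) := ⟨by linarith, by linarith⟩
  have hsq : Tendsto (fun t => ‖nemytskii hh t x - nemytskii hh s x‖ ^ 2) (𝓝 s) (𝓝 0) := by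
    simp only [norm_sq_eq_tsum]
    have h0 : (0 : ℝ) = ∑' _ : ℤ, (0 : ℝ) := tsum_zero.symm
    rw [h0]
    refine tendsto_tsum_of_dominated_convergence (bound := fun i => (2 * K) ^ 2 * x i ^ 2)
      ((summable_sq x).mul_left _) (fun i => ?_) ?_
    · have hc : Continuous fun t => (h i t (x i) - h i s (x i)) ^ 2 :=
        ((hh.continuous_time i (x i)).sub continuous_const).pow 2
      simpa [nemytskii_apply] using hc.tendsto s
    · filter_upwards [Icc_mem_nhds (show s - 1 < s by linarith) (show s < s + 1 by linarith)]
        with t ht i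
      rw [lp.coeFn_sub, Pi.sub_apply, nemytskii_apply, nemytskii_apply, Real.norm_eq_abs,
        abs_of_nonneg (sq_nonneg _), ← mul_pow, ← sq_abs, ← sq_abs (2 * K * x i)]
      refine pow_le_pow_left₀ (abs_nonneg _) ?_ 2
      rw [abs_mul, abs_of_nonneg (by positivity : 0 ≤ 2 * K)]
      linarith [abs_sub (h i t (x i)) (h i s (x i)), hb t ht i, hb s hs i]
  rw [ContinuousAt, tendsto_iff_norm_sub_tendsto_zero]
  simpa using hsq.sqrt

/-- A coordinatewise one-sided bound gives a one-sided bound for the Nemytskii operator. -/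
lemma inner_nemytskii_le {h : ℤ → ℝ → ℝ → ℝ} (hh : IsUniformlyLocLip h) {t c : ℝ}
    (hc : ∀ i x, h i t x * x ≤ c * x ^ 2) (x : l2) :
    inner ℝ (nemytskii hh t x) x ≤ c * ‖x‖ ^ 2 := by
  rw [norm_sq_eq_tsum, ← tsum_mul_left, lp.inner_eq_tsum]
  refine (lp.summable_inner (𝕜 := ℝ) (nemytskii hh t x) x).tsum_le_tsum (fun i => ?_)
    ((summable_sq x).mul_left c)
  rw [real_inner_comm]
  simpa [nemytskii_apply, mul_comm] using hc i (x i)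

lemma memℓp_shift (k : ℤ) (x : l2) : Memℓp (fun i => x (i + k)) 2 := by
  refine memℓp_gen ?_
  exact ((lp.memℓp x).summable (by simp)).comp_injective (add_left_injective k)

/-- The shift by `k` as a linear isometry of `ℓ²`. -/
def shift (k : ℤ) : l2 →ₗᵢ[ℝ] l2 where
  toFun x := ⟨fun i => x (i + k), memℓp_shift k x⟩
  map_add' _ _ := rfl
  map_smul' _ _ := rfl
  norm_map' x := by
    rw [← sq_eq_sq₀ (norm_nonneg _) (norm_nonneg _), norm_sq_eq_tsum, norm_sq_eq_tsum]
    exact (Equiv.addRight k).tsum_eq fun i => x i ^ 2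

lemma shift_apply (k : ℤ) (x : l2) (i : ℤ) : shift k x i = x (i + k) := rfl

/-- The discrete Laplacian `(A x)_i = -x_{i-1} + 2 x_i - x_{i+1}`. -/
def discreteLaplacian (x : l2) : l2 := (2 : ℝ) • x - shift (-1) x - shift 1 x

lemma discreteLaplacian_apply (x : l2) (i : ℤ) :
    discreteLaplacian x i = -(x (i - 1)) + 2 * x i - x (i + 1) := by
  simp only [discreteLaplacian, lp.coeFn_sub, Pi.sub_apply, lp.coeFn_smul, Pi.smul_apply,
    shift_apply, smul_eq_mul]
  rw [← sub_eq_add_neg]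
  ring

lemma norm_discreteLaplacian_le (x : l2) : ‖discreteLaplacian x‖ ≤ 4 * ‖x‖ := by
  have h1 := norm_sub_le ((2 : ℝ) • x - shift (-1) x) (shift 1 x)
  have h2 := norm_sub_le ((2 : ℝ) • x) (shift (-1) x)
  rw [norm_smul, LinearIsometry.norm_map, Real.norm_two] at h2
  rw [LinearIsometry.norm_map] at h1
  rw [discreteLaplacian]
  linarith

lemma lipschitzWith_discreteLaplacian : LipschitzWith 4 discreteLaplacian := by
  refine LipschitzWith.of_dist_le_mul fun x y => ?_
  rw [dist_eq_norm, dist_eq_norm]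
  have : discreteLaplacian x - discreteLaplacian y = discreteLaplacian (x - y) := by
    simp only [discreteLaplacian, map_sub, smul_sub]
    abel
  rw [this]
  exact norm_discreteLaplacian_le _

end LatticeOperators

section ReactionTerm

/-- Multiplication by a uniformly bounded sequence of continuous functions of time. -/
lemma isUniformlyLocLip_mul {c : ℤ → ℝ → ℝ} {M : ℝ} (hc : ∀ i, Continuous (c i))
    (hM : 0 ≤ M) (hb : ∀ i t, |c i t| ≤ M) : IsUniformlyLocLip fun i t x => c i t * x where
  map_zero _ _ := mul_zero _
  continuous_time i x := (hc i).mul continuous_const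
  exists_lipschitz _ _ _ := ⟨M, hM, fun t _ i x y _ _ => by
    rw [← mul_sub, abs_mul]
    exact mul_le_mul_of_nonneg_right (hb i t) (abs_nonneg _)⟩

variable {lam : ℤ → ℝ → ℝ} {f : ℤ → ℝ → ℝ → ℝ} {ζ : ℝ → ℝ → ℝ} {z : ℝ → ℝ}

lemma exists_forall_abs_sub_le_of_deriv_bound
    (hfx : ∀ i t, Differentiable ℝ fun x => f i x t)
    (hζc : Continuous (Function.uncurry ζ))
    (hζ : ∀ ι t : ℝ, 0 ≤ ι → ∀ i x, |x| ≤ ι → |deriv (fun y => f i y t) x| ≤ ζ ι t)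
    (a b ι : ℝ) (hι : 0 ≤ ι) :
    ∃ M : ℝ, 0 ≤ M ∧ ∀ t ∈ Icc a b, ∀ i x y, |x| ≤ ι → |y| ≤ ι →
      |f i x t - f i y t| ≤ M * |x - y| := by
  have hζι : Continuous (ζ ι) := hζc.comp (Continuous.prodMk_right ι)
  obtain ⟨M, hM⟩ := isCompact_Icc.exists_bound_of_continuousOn (hζι.continuousOn (s := Icc a b))
  refine ⟨|M|, abs_nonneg M, fun t ht i x y hx hy => ?_⟩
  refine (convex_Icc (-ι) ι).norm_image_sub_le_of_norm_deriv_le (f := fun x => f i x t)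
    (fun w _ => hfx i t w) (fun w hw => ?_) (abs_le.1 hy) (abs_le.1 hx)
  exact (hζ ι t hι i w (abs_le.2 hw)).trans
    ((le_abs_self _).trans ((hM t ht).trans (le_abs_self M)))

/-- The zeroth-order term of the transformed lattice equation, one coordinate at a time. -/
def reaction (lam : ℤ → ℝ → ℝ) (f : ℤ → ℝ → ℝ → ℝ) (z : ℝ → ℝ) (i : ℤ) (t x : ℝ) : ℝ :=
  -(lam i t * x) - Real.exp (-z t) * f i (Real.exp (z t) * x) t + z t * x

lemma continuous_comp_of_locLip
    (hft : ∀ i x, Continuous fun t => f i x t)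
    (hfL : ∀ a b ι : ℝ, 0 ≤ ι → ∃ M : ℝ, 0 ≤ M ∧ ∀ t ∈ Icc a b, ∀ i x y, |x| ≤ ι → |y| ≤ ι →
      |f i x t - f i y t| ≤ M * |x - y|)
    {p : ℝ → ℝ} (hp : Continuous p) (i : ℤ) : Continuous fun t => f i (p t) t := by
  refine continuous_iff_continuousAt.2 fun s => ?_
  obtain ⟨B, hB⟩ := isCompact_Icc.exists_bound_of_continuousOn
    (hp.continuousOn (s := Icc (s - 1) (s + 1)))
  have hs : s ∈ Icc (s - 1) (s + 1) := ⟨by linarith, by linarith⟩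
  obtain ⟨M, -, hL⟩ := hfL (s - 1) (s + 1) B ((norm_nonneg _).trans (hB s hs))
  rw [ContinuousAt, tendsto_iff_dist_tendsto_zero]
  have hlim : Continuous fun t => M * |p t - p s| + |f i (p s) t - f i (p s) s| :=
    (continuous_const.mul (hp.sub continuous_const).abs).add
      ((hft i (p s)).sub continuous_const).abs
  refine squeeze_zero' (Eventually.of_forall fun t => dist_nonneg) ?_
    (by simpa using hlim.tendsto s)
  filter_upwards [Icc_mem_nhds (show s - 1 < s by linarith) (show s < s + 1 by linarith)]
    with t ht
  rw [Real.dist_eq]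
  have := hL t ht i (p t) (p s) (hB t ht) (hB s hs)
  linarith [abs_sub_le (f i (p t) t) (f i (p s) t) (f i (p s) s)]

lemma isUniformlyLocLip_reaction {lamUp : ℝ} (hlamc : ∀ i, Continuous (lam i))
    (hlam : ∀ i t, |lam i t| ≤ lamUp)
    (hft : ∀ i x, Continuous fun t => f i x t) (hf0 : ∀ i t, f i 0 t = 0)
    (hfL : ∀ a b ι : ℝ, 0 ≤ ι → ∃ M : ℝ, 0 ≤ M ∧ ∀ t ∈ Icc a b, ∀ i x y, |x| ≤ ι → |y| ≤ ι →
      |f i x t - f i y t| ≤ M * |x - y|)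
    (hz : Continuous z) : IsUniformlyLocLip (reaction lam f z) where
  map_zero i t := by simp [reaction, hf0]
  continuous_time i x := by
    have := continuous_comp_of_locLip hft hfL (p := fun t => Real.exp (z t) * x) (by fun_prop) i
    have hli := hlamc i
    exact ((hli.mul continuous_const).neg.sub ((Real.continuous_exp.comp hz.neg).mul this)).add
      (hz.mul continuous_const)
  exists_lipschitz a b R := by
    obtain ⟨Z, hZ⟩ := isCompact_Icc.exists_bound_of_continuousOn (hz.continuousOn (s := Icc a b))
    obtain ⟨M, hM, hL⟩ := hfL a b (Real.exp Z * |R|) (by positivity)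
    refine ⟨|lamUp| + M + |Z|, by positivity, fun t ht i x y hx hy => ?_⟩
    have hzt : |z t| ≤ |Z| := (hZ t ht).trans (le_abs_self Z)
    have hscale : ∀ w, |w| ≤ R → |Real.exp (z t) * w| ≤ Real.exp Z * |R| := fun w hw => by
      rw [abs_mul, Real.abs_exp]
      have := (le_abs_self _).trans (hZ t ht)
      have := hw.trans (le_abs_self R)
      gcongr
    have hf := hL t ht i _ _ (hscale x hx) (hscale y hy)
    rw [← mul_sub, abs_mul, Real.abs_exp] at hf
    have hexp : Real.exp (-z t) * Real.exp (z t) = 1 := by rw [← Real.exp_add]; simp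
    have h1 : |lam i t * (x - y)| ≤ |lamUp| * |x - y| := by
      rw [abs_mul]
      exact mul_le_mul_of_nonneg_right ((hlam i t).trans (le_abs_self _)) (abs_nonneg _)
    have h2 : |Real.exp (-z t) * (f i (Real.exp (z t) * x) t - f i (Real.exp (z t) * y) t)|
        ≤ M * |x - y| := by
      rw [abs_mul, Real.abs_exp]
      calc _ ≤ Real.exp (-z t) * (M * (Real.exp (z t) * |x - y|)) := by gcongr
        _ = Real.exp (-z t) * Real.exp (z t) * (M * |x - y|) := by ring
        _ = M * |x - y| := by rw [hexp, one_mul]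
    have h3 : |z t * (x - y)| ≤ |Z| * |x - y| := by
      rw [abs_mul]
      exact mul_le_mul_of_nonneg_right hzt (abs_nonneg _)
    have heq : reaction lam f z i t x - reaction lam f z i t y = -(lam i t * (x - y))
        - Real.exp (-z t) * (f i (Real.exp (z t) * x) t - f i (Real.exp (z t) * y) t)
        + z t * (x - y) := by
      simp only [reaction]; ring
    rw [heq]
    rw [abs_le] at *
    constructor <;> linarith

lemma neg_mul_sq_le_mul_of_deriv_ge {φ : ℝ → ℝ} {β : ℝ} (hφ : Differentiable ℝ φ) (h0 : φ 0 = 0)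
    (hd : ∀ x, -β ≤ deriv φ x) (x : ℝ) : -β * x ^ 2 ≤ φ x * x := by
  have hmono : Monotone fun x => φ x + β * x := by
    refine monotone_of_deriv_nonneg (by fun_prop) fun y => ?_
    have hy : HasDerivAt (fun x => φ x + β * x) (deriv φ y + β * 1) y :=
      (hφ y).hasDerivAt.add ((hasDerivAt_id y).const_mul β)
    rw [hy.deriv]
    linarith [hd y]
  rcases le_total 0 x with hx | hx
  · have := hmono hx
    simp only [h0, mul_zero, add_zero] at this
    nlinarith
  · have := hmono hx
    simp only [h0, mul_zero, add_zero] at this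
    nlinarith

lemma reaction_mul_le {β Z : ℝ} {i : ℤ} {t : ℝ} (hlam : 0 ≤ lam i t)
    (hfx : Differentiable ℝ fun x => f i x t) (hf0 : f i 0 t = 0)
    (hdf : ∀ x, -β ≤ deriv (fun y => f i y t) x) (hz : |z t| ≤ Z) (x : ℝ) :
    reaction lam f z i t x * x ≤ (β + Z) * x ^ 2 := by
  have hexp : Real.exp (-z t) * Real.exp (z t) = 1 := by rw [← Real.exp_add]; simp
  have h1 : -β * x ^ 2 ≤ Real.exp (-z t) * f i (Real.exp (z t) * x) t * x := by
    have h := mul_le_mul_of_nonneg_left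
      (neg_mul_sq_le_mul_of_deriv_ge hfx hf0 hdf (Real.exp (z t) * x))
      (sq_nonneg (Real.exp (-z t)))
    calc -β * x ^ 2 = (Real.exp (-z t) * Real.exp (z t)) ^ 2 * (-β * x ^ 2) := by
          rw [hexp]; ring
      _ = Real.exp (-z t) ^ 2 * (-β * (Real.exp (z t) * x) ^ 2) := by ring
      _ ≤ _ := h
      _ = (Real.exp (-z t) * Real.exp (z t))
          * (Real.exp (-z t) * f i (Real.exp (z t) * x) t * x) := by ring
      _ = _ := by rw [hexp, one_mul]
  have h2 : z t * x ^ 2 ≤ Z * x ^ 2 :=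
    mul_le_mul_of_nonneg_right ((le_abs_self _).trans hz) (sq_nonneg x)
  have h3 : 0 ≤ lam i t * x ^ 2 := by positivity
  unfold reaction
  nlinarith

end ReactionTerm

theorem stmt18
    -- the data
    (nu lam : ℤ → ℝ → ℝ) (lam₀ lamUp nu₀ nuUp β : ℝ)
    (f : ℤ → ℝ → ℝ → ℝ) (α g : ℝ → l2) (ζ : ℝ → ℝ → ℝ) (z : ℝ → ℝ)
    -- (A1)
    (hnuc : ∀ i : ℤ, Continuous (nu i)) (hlamc : ∀ i : ℤ, Continuous (lam i))
    (hlam₀ : 0 < lam₀) (hnu₀ : 0 < nu₀)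
    (hlam : ∀ (i : ℤ) (t : ℝ), lam₀ ≤ lam i t ∧ lam i t ≤ lamUp)
    (hnu : ∀ (i : ℤ) (t : ℝ), nu₀ ≤ nu i t ∧ nu i t ≤ nuUp)
    -- (A2)
    (hfx : ∀ (i : ℤ) (t : ℝ), Differentiable ℝ fun x => f i x t)
    (hft : ∀ (i : ℤ) (x : ℝ), Continuous fun t => f i x t)
    (hf0 : ∀ (i : ℤ) (t : ℝ), f i 0 t = 0)
    (hαc : Continuous α) (hαb : ∃ C : ℝ, ∀ t : ℝ, ‖α t‖ ≤ C)
    (hsign : ∀ (i : ℤ) (x t : ℝ), x * f i x t ≥ -(α t i ^ 2))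
    (hβ : 0 ≤ β)
    (hdf : ∀ (i : ℤ) (x t : ℝ), deriv (fun y => f i y t) x ≥ -β)
    -- (A3)
    (hζc : Continuous (Function.uncurry ζ)) (hζ0 : ∀ ι t : ℝ, 0 ≤ ι → 0 ≤ ζ ι t)
    (hζ : ∀ ι t : ℝ, 0 ≤ ι → ∀ (i : ℤ) (x : ℝ), |x| ≤ ι →
      |deriv (fun y => f i y t) x| ≤ ζ ι t)
    -- (A4)
    (hgc : Continuous g) (hgb : ∃ C : ℝ, ∀ t : ℝ, ‖g t‖ ≤ C)
    -- z continuous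
    (hz : Continuous z)
    -- initial data
    (τ : ℝ) (vτ : l2) :
    ∃ v v' : ℝ → l2,
      v τ = vτ ∧
      IsSolOn nu lam f g z v v' (Set.Ici τ) ∧
      ∀ u u' : ℝ → l2, u τ = vτ →
        IsSolOn nu lam f g z u u' (Set.Ici τ) →
        ∀ t ∈ Set.Ici τ, u t = v t := by
  have hnu_abs : ∀ i t, |nu i t| ≤ nuUp := fun i t =>
    abs_le.2 ⟨by linarith [hnu i t], (hnu i t).2⟩
  have hlam_abs : ∀ i t, |lam i t| ≤ lamUp := fun i t =>
    abs_le.2 ⟨by linarith [hlam i t], (hlam i t).2⟩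
  have hnuUp : 0 ≤ nuUp := (abs_nonneg _).trans (hnu_abs 0 0)
  have hN : IsUniformlyLocLip fun i t x => nu i t * x := isUniformlyLocLip_mul hnuc hnuUp hnu_abs
  have hH : IsUniformlyLocLip (reaction lam f z) :=
    isUniformlyLocLip_reaction hlamc hlam_abs hft hf0
      (exists_forall_abs_sub_le_of_deriv_bound hfx hζc hζ) hz
  set F : ℝ → l2 → l2 := fun t x =>
    -nemytskii hN t (discreteLaplacian x) + nemytskii hH t x + Real.exp (-z t) • g t with hF
  have hFapply : ∀ t x i, F t x i = latticeRHS nu lam f g z x t i := fun t x i => by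
    simp only [hF, lp.coeFn_add, lp.coeFn_neg, lp.coeFn_smul, Pi.add_apply, Pi.neg_apply,
      Pi.smul_apply, nemytskii_apply, discreteLaplacian_apply, smul_eq_mul, reaction, latticeRHS]
    ring
  have hlip : ∀ b R : ℝ, ∃ K : ℝ≥0, ∀ t ∈ Icc τ b, LipschitzOnWith K (F t) (closedBall 0 R) := by
    intro b R
    obtain ⟨K₁, hK₁⟩ := exists_lipschitzOnWith_nemytskii hN τ b (4 * R)
    obtain ⟨K₂, hK₂⟩ := exists_lipschitzOnWith_nemytskii hH τ b R
    refine ⟨K₁ * 4 + K₂ + 0, fun t ht => ?_⟩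
    refine LipschitzOnWith.add (LipschitzOnWith.add (LipschitzOnWith.neg ?_) (hK₂ t ht))
      (LipschitzWith.const _).lipschitzOnWith
    refine (hK₁ t ht).comp lipschitzWith_discreteLaplacian.lipschitzOnWith fun x hx => ?_
    rw [mem_closedBall_zero_iff] at hx ⊢
    linarith [norm_discreteLaplacian_le x]
  have hcont : ∀ x, Continuous fun t => F t x := fun x =>
    ((continuous_nemytskii hN _).neg.add (continuous_nemytskii hH x)).add
      ((Real.continuous_exp.comp hz.neg).smul hgc)
  have henergy : ∀ b, ∃ C, 0 ≤ C ∧ ∀ t ∈ Icc τ b, ∀ x, inner ℝ (F t x) x ≤ C * (1 + ‖x‖ ^ 2) := by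
    intro b
    obtain ⟨Z, hZ⟩ := isCompact_Icc.exists_bound_of_continuousOn (hz.continuousOn (s := Icc τ b))
    obtain ⟨G, hG⟩ := isCompact_Icc.exists_bound_of_continuousOn
      (((Real.continuous_exp.comp hz.neg).smul hgc).continuousOn (s := Icc τ b))
    refine ⟨4 * nuUp + (β + |Z|) + |G|, by positivity, fun t ht x => ?_⟩
    have h1 : inner ℝ (-nemytskii hN t (discreteLaplacian x)) x ≤ 4 * nuUp * ‖x‖ ^ 2 := by
      have hn : ‖nemytskii hN t (discreteLaplacian x)‖ ≤ nuUp * ‖discreteLaplacian x‖ := by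
        refine norm_le_mul_norm_of_abs_le hnuUp fun i => ?_
        rw [nemytskii_apply, abs_mul]
        exact mul_le_mul_of_nonneg_right (hnu_abs i t) (abs_nonneg _)
      have hA := mul_le_mul_of_nonneg_left (norm_discreteLaplacian_le x) hnuUp
      calc _ ≤ ‖-nemytskii hN t (discreteLaplacian x)‖ * ‖x‖ := real_inner_le_norm _ _
        _ ≤ nuUp * (4 * ‖x‖) * ‖x‖ := by
            rw [norm_neg]
            exact mul_le_mul_of_nonneg_right (hn.trans hA) (norm_nonneg _)
        _ = _ := by ring
    have h2 : inner ℝ (nemytskii hH t x) x ≤ (β + |Z|) * ‖x‖ ^ 2 :=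
      inner_nemytskii_le hH (fun i y => reaction_mul_le (hlam₀.le.trans (hlam i t).1) (hfx i t)
        (hf0 i t) (hdf i · t) ((hZ t ht).trans (le_abs_self Z)) y) x
    have h3 : inner ℝ (Real.exp (-z t) • g t) x ≤ |G| * (1 + ‖x‖ ^ 2) := by
      refine (real_inner_le_norm _ _).trans (mul_le_mul ((hG t ht).trans (le_abs_self G)) ?_
        (norm_nonneg _) (abs_nonneg _))
      nlinarith [sq_nonneg (‖x‖ - 1)]
    rw [hF, inner_add_left, inner_add_left]
    nlinarith [abs_nonneg Z]
  obtain ⟨v, hv0, hv⟩ := exists_solution_Ici_of_energy hlip hcont henergy vτ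
  refine ⟨v, fun t => F t (v t), hv0, fun t ht => ⟨hv t ht, hFapply t (v t)⟩, ?_⟩
  intro u u' hu0 hu t ht
  have hu' : ∀ s ∈ Ici τ, u' s = F s (u s) := fun s hs =>
    lp.ext (funext fun i => ((hu s hs).2 i).trans (hFapply s (u s) i).symm)
  refine eqOn_of_lipschitzOn_balls (b := t) (hlip t)
    (fun s hs => ?_) (fun s hs => (hv s hs.1).mono Icc_subset_Ici_self)
    (hu0.trans hv0.symm) ⟨ht, le_rfl⟩
  rw [← hu' s hs.1]
  exact (hu s hs.1).1.mono Icc_subset_Ici_self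
end
end
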